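/- For every integer n ≥ 1 the quantities b_{i,j} satisfy: b_{1,1}(4n) = b_{1,1}(2n)+2·a_{1,2}(2n)+a_{1,1}(2n+1); b_{1,2}(4n) = a_{1,2}(4n); b_{2,1}(4n) = a_{1,1}(4n+1); b_{2,2}(4n) = a_{2,2}(4n); b_{1,1}(4n+1) = a_{1,1}(4n+1); b_{1,2}(4n+1) = 2·a_{1,2}(2n)+2·b_{1,2}(2n+1); b_{2,1}(4n+1) = a_{2,1}(4n+1); b_{2,2}(4n+1) = a_{1,2}(4n+2); b_{1,1}(4n+2) = a_{1,1}(2n+1)+b_{1,2}(2n+1)+a_{1,1}(2n+2)+a_{1,2}(2n+2); b_{1,2}(4n+2) = a_{1,2}(4n+2); b_{2,1}(4n+2) = a_{1,1}(4n+3); b_{2,2}(4n+2) = a_{2,2}(4n+2); b_{1,1}(4n+3) = a_{1,1}(4n+3); b_{1,2}(4n+3) = 2·b_{1,2}(2n+1)+2·a_{1,2}(2n+2); b_{2,1}(4n+3) = a_{2,1}(4n+3); b_{2,2}(4n+3) = 4·a_{1,2}(2n+2). -/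

import Mathlib

/-- The 16-letter alphabet 𝒜 = {A,…,P}. -/
inductive A16 : Type
  | A | B | C | D | E | F | G | H | I | J | K | L | M | N | O | P
  deriving DecidableEq

/-- The 2×2 block substitution μ on 𝒜 (rows top to bottom). -/
def mu : A16 → Fin 2 → Fin 2 → A16
  | .A => ![![.A, .F], ![.G, .C]]
  | .B => ![![.A, .F], ![.H, .D]]
  | .C => ![![.B, .E], ![.G, .C]]
  | .D => ![![.B, .E], ![.H, .D]]
  | .E => ![![.A, .N], ![.G, .K]]
  | .F => ![![.A, .N], ![.H, .L]]
  | .G => ![![.B, .M], ![.G, .K]]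
  | .H => ![![.B, .M], ![.H, .L]]
  | .I => ![![.I, .F], ![.O, .C]]
  | .J => ![![.I, .F], ![.P, .D]]
  | .K => ![![.J, .E], ![.O, .C]]
  | .L => ![![.J, .E], ![.P, .D]]
  | .M => ![![.I, .N], ![.O, .K]]
  | .N => ![![.I, .N], ![.P, .L]]
  | .O => ![![.J, .M], ![.O, .K]]
  | .P => ![![.J, .M], ![.P, .L]]

/-- Entry version of μ, indexed by arbitrary naturals (via mod 2). -/
def muE (x : A16) (r c : ℕ) : A16 :=
  mu x ⟨r % 2, by omega⟩ ⟨c % 2, by omega⟩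

/-- `superE n x` is the supertile μⁿ(x), a 2ⁿ×2ⁿ array over 𝒜,
given as a total function on ℕ × ℕ (only indices < 2ⁿ are relevant). -/
def superE : ℕ → A16 → ℕ → ℕ → A16
  | 0, x, _, _ => x
  | n + 1, x, r, c => muE (superE n x (r / 2) (c / 2)) r c

/-- The supertile T_k = μᵏ(N). -/
def Tfun (k : ℕ) : ℕ → ℕ → A16 := superE k .N

/-- An m×n pattern over the alphabet α. -/
abbrev Pat (α : Type) (m n : ℕ) := Fin m → Fin n → α

/-- The set of m×n patterns occurring in the size×size array X. -/
def patIn {α : Type} (X : ℕ → ℕ → α) (size m n : ℕ) : Set (Pat α m n) :=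
  { p | ∃ r c : ℕ, r + m ≤ size ∧ c + n ≤ size ∧
      ∀ (i : Fin m) (j : Fin n), p i j = X (r + i) (c + j) }

/-- P(T, m×n) = ⋃ₖ P(T_k, m×n). -/
def PT (m n : ℕ) : Set (Pat A16 m n) := ⋃ k : ℕ, patIn (Tfun k) (2 ^ k) m n

/-- μ applied to an m×n pattern, as a total 2m×2n array on ℕ × ℕ
(indices are reduced mod the valid range; in range this is exactly μ(p)). -/
def muPatE {m n : ℕ} (p : Pat A16 m n) (r c : ℕ) : A16 :=
  if hm : 0 < m then
    if hn : 0 < n then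
      muE (p ⟨r / 2 % m, Nat.mod_lt _ hm⟩ ⟨c / 2 % n, Nat.mod_lt _ hn⟩) r c
    else .A
  else .A

/-- μ² applied to an m×n pattern, as a total 4m×4n array on ℕ × ℕ. -/
def mu2PatE {m n : ℕ} (p : Pat A16 m n) (r c : ℕ) : A16 :=
  muE (muPatE p (r / 2) (c / 2)) r c

/-- P_{i,j}(T, m×n) = { μ(x)[i,j,m×n] : x ∈ P(T,m×n) } (1-based corner (i,j)). -/
def Pij (i j m n : ℕ) : Set (Pat A16 m n) :=
  { q | ∃ x ∈ PT m n, ∀ (a : Fin m) (b : Fin n),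
      q a b = muPatE x (i - 1 + a) (j - 1 + b) }

/-- Q_{i,j}(T, m×n) = { μ²(x)[i,j,m×n] : x ∈ P(T,m×n) } (1-based corner (i,j)). -/
def Qij (i j m n : ℕ) : Set (Pat A16 m n) :=
  { q | ∃ x ∈ PT m n, ∀ (a : Fin m) (b : Fin n),
      q a b = mu2PatE x (i - 1 + a) (j - 1 + b) }

/-- The 2×2 block substitution φ from 𝒜 to ℬ = {0,1,2,3}. -/
def phi : A16 → Fin 2 → Fin 2 → Fin 4
  | .A => ![![0, 1], ![0, 0]]
  | .B => ![![0, 1], ![1, 1]]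
  | .C => ![![1, 0], ![0, 0]]
  | .D => ![![1, 0], ![1, 1]]
  | .E => ![![0, 3], ![0, 2]]
  | .F => ![![0, 3], ![1, 3]]
  | .G => ![![1, 2], ![0, 2]]
  | .H => ![![1, 2], ![1, 3]]
  | .I => ![![2, 1], ![2, 0]]
  | .J => ![![2, 1], ![3, 1]]
  | .K => ![![3, 0], ![2, 0]]
  | .L => ![![3, 0], ![3, 1]]
  | .M => ![![2, 3], ![2, 2]]
  | .N => ![![2, 3], ![3, 3]]
  | .O => ![![3, 2], ![2, 2]]
  | .P => ![![3, 2], ![3, 3]]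

/-- Entry version of φ, indexed by arbitrary naturals (via mod 2). -/
def phiE (x : A16) (r c : ℕ) : Fin 4 :=
  phi x ⟨r % 2, by omega⟩ ⟨c % 2, by omega⟩

/-- φ applied to an m×n pattern over 𝒜, as a total 2m×2n array on ℕ × ℕ. -/
def phiPatE {m n : ℕ} (p : Pat A16 m n) (r c : ℕ) : Fin 4 :=
  if hm : 0 < m then
    if hn : 0 < n then
      phiE (p ⟨r / 2 % m, Nat.mod_lt _ hm⟩ ⟨c / 2 % n, Nat.mod_lt _ hn⟩) r c
    else 0
  else 0

/-- φ(T_k), a 2^(k+1)×2^(k+1) array over ℬ. -/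
def Sfun (k : ℕ) (r c : ℕ) : Fin 4 := phiE (Tfun k (r / 2) (c / 2)) r c

/-- P(S, m×n) = ⋃_{k≥1} P(φ(T_{k-1}), m×n). -/
def PS (m n : ℕ) : Set (Pat (Fin 4) m n) :=
  ⋃ k : ℕ, patIn (Sfun k) (2 ^ (k + 1)) m n

/-- P_{i,j}(S, m×n) = { φ(x)[i,j,m×n] : x ∈ P(T,m×n) } (1-based corner (i,j)). -/
def PSij (i j m n : ℕ) : Set (Pat (Fin 4) m n) :=
  { q | ∃ x ∈ PT m n, ∀ (a : Fin m) (b : Fin n),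
      q a b = phiPatE x (i - 1 + a) (j - 1 + b) }

/-- A_n = |P(S, n×n)|. -/
noncomputable def Acnt (n : ℕ) : ℕ := Nat.card (PS n n)

/-- a_{i,j}(n) = |P_{i,j}(T, n×n)|. -/
noncomputable def aT (i j n : ℕ) : ℕ := Nat.card (Pij i j n n)

/-- b_{i,j}(n) = |P_{i,j}(T, n×(n+1))|. -/
noncomputable def bT (i j n : ℕ) : ℕ := Nat.card (Pij i j n (n + 1))

/-- c_{i,j}(n) = |P_{i,j}(T, (n+1)×n)|. -/
noncomputable def cT (i j n : ℕ) : ℕ := Nat.card (Pij i j (n + 1) n)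

/-- The fixed point of `mu` in the quarter plane that grows from the letter `I`. -/
def quarterPlane (r c : ℕ) : A16 := superE (r + c) .I r c

theorem superE_succ_of_corner {x : A16} (hx : muE x 0 0 = .I) (k : ℕ) :
    ∀ {r c : ℕ}, r < 2 ^ k → c < 2 ^ k → superE (k + 1) x r c = superE k .I r c := by
  induction k with
  | zero =>
    intro r c hr hc
    obtain rfl : r = 0 := by simpa using hr
    obtain rfl : c = 0 := by simpa using hc
    simpa [superE] using hx
  | succ k ih =>
    intro r c hr hc
    rw [pow_succ] at hr hc
    rw [superE, ih (by omega) (by omega), superE]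

theorem superE_add_I (k d : ℕ) {r c : ℕ} (hr : r < 2 ^ k) (hc : c < 2 ^ k) :
    superE (k + d) .I r c = superE k .I r c := by
  induction d with
  | zero => rfl
  | succ d ih =>
    have h : 2 ^ k ≤ 2 ^ (k + d) := Nat.pow_le_pow_right (by norm_num) (by omega)
    rw [← add_assoc, superE_succ_of_corner rfl _ (by omega) (by omega), ih]

theorem superE_I_eq_quarterPlane {k r c : ℕ} (hr : r < 2 ^ k) (hc : c < 2 ^ k) :
    superE k .I r c = quarterPlane r c := by
  have h : r + c < 2 ^ (r + c) := Nat.lt_two_pow_self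
  rw [quarterPlane, ← superE_add_I k (r + c) hr hc, add_comm,
    superE_add_I (r + c) k (by omega) (by omega)]

theorem quarterPlane_eq_muE (r c : ℕ) :
    quarterPlane r c = muE (quarterPlane (r / 2) (c / 2)) r c := by
  have h : r + c < 2 ^ (r + c) := Nat.lt_two_pow_self
  rw [← superE_I_eq_quarterPlane (k := r + c + 1) (by rw [pow_succ]; omega)
    (by rw [pow_succ]; omega), superE,
    superE_I_eq_quarterPlane (by omega) (by omega)]

theorem superE_quarterPlane (R C k : ℕ) : ∀ {r c : ℕ}, r < 2 ^ k → c < 2 ^ k →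
    superE k (quarterPlane R C) r c = quarterPlane (2 ^ k * R + r) (2 ^ k * C + c) := by
  induction k with
  | zero =>
    intro r c hr hc
    obtain rfl : r = 0 := by simpa using hr
    obtain rfl : c = 0 := by simpa using hc
    simp [superE]
  | succ k ih =>
    intro r c hr hc
    rw [pow_succ] at hr hc
    have aux : ∀ S s : ℕ, (2 ^ (k + 1) * S + s) / 2 = 2 ^ k * S + s / 2 ∧
        (2 ^ (k + 1) * S + s) % 2 = s % 2 := by
      intro S s
      have : 2 ^ (k + 1) * S = 2 * (2 ^ k * S) := by ring
      omega
    rw [superE, ih (by omega) (by omega), quarterPlane_eq_muE (2 ^ (k + 1) * R + r)]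
    simp only [muE, aux]

theorem PT_eq_range (m n : ℕ) :
    PT m n = Set.range fun (p : ℕ × ℕ) (a : Fin m) (b : Fin n) =>
      quarterPlane (p.1 + a) (p.2 + b) := by
  ext x
  simp only [PT, patIn, Set.mem_iUnion, Set.mem_ofPred_eq, Set.mem_range, Prod.exists]
  constructor
  · rintro ⟨k, r, c, hr, hc, hx⟩
    refine ⟨2 ^ k * 0 + r, 2 ^ k * 3 + c, ?_⟩
    funext a b
    have hN : quarterPlane 0 3 = .N := by decide
    rw [hx, Tfun, ← hN, superE_quarterPlane _ _ _ (by omega) (by omega), add_assoc, add_assoc]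
  · rintro ⟨r, c, rfl⟩
    have h : r + c + m + n < 2 ^ (r + c + m + n) := Nat.lt_two_pow_self
    refine ⟨r + c + m + n + 1, r, c, by rw [pow_succ]; omega, by rw [pow_succ]; omega, ?_⟩
    intro a b
    rw [Tfun, superE_succ_of_corner rfl _ (by omega) (by omega),
      superE_I_eq_quarterPlane (by omega) (by omega)]

theorem Pij_eq_range {i j m n : ℕ} (hi : i < 2) (hj : j < 2) (hm : 1 ≤ m) (hn : 1 ≤ n) :
    Pij (i + 1) (j + 1) m n = Set.range fun (p : ℕ × ℕ) (a : Fin m) (b : Fin n) =>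
      quarterPlane (2 * p.1 + i + a) (2 * p.2 + j + b) := by
  have key : ∀ (p : ℕ × ℕ) (a : Fin m) (b : Fin n),
      muPatE (fun (a : Fin m) (b : Fin n) => quarterPlane (p.1 + a) (p.2 + b))
        (i + 1 - 1 + a) (j + 1 - 1 + b) = quarterPlane (2 * p.1 + i + a) (2 * p.2 + j + b) := by
    intro p a b
    have aux : ∀ R s t : ℕ, (2 * R + s + t) / 2 = R + (s + t) / 2 ∧
        (2 * R + s + t) % 2 = (s + t) % 2 := by omega
    rw [muPatE, dif_pos (by omega), dif_pos (by omega), quarterPlane_eq_muE (2 * p.1 + i + a)]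
    have ha : (i + a) / 2 % m = (i + a) / 2 := Nat.mod_eq_of_lt (by omega)
    have hb : (j + b) / 2 % n = (j + b) / 2 := Nat.mod_eq_of_lt (by omega)
    simp only [muE, aux, Nat.add_sub_cancel, ha, hb]
  ext q
  simp only [Pij, PT_eq_range, Set.mem_ofPred_eq, Set.mem_range]
  constructor
  · rintro ⟨_, ⟨p, rfl⟩, hq⟩
    exact ⟨p, by funext a b; rw [hq, key]⟩
  · rintro ⟨p, rfl⟩
    exact ⟨_, ⟨p, rfl⟩, fun a b => (key p a b).symm⟩

/-- The bit of a letter that `mu` copies to the left column of its image. -/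
def leftBit : A16 → Bool
  | .I | .J | .K | .L | .M | .N | .O | .P => true
  | _ => false

/-- The bit of a letter that `mu` copies to the right column of its image. -/
def rightBit : A16 → Bool
  | .E | .F | .G | .H | .M | .N | .O | .P => true
  | _ => false

/-- The bit of a letter that `mu` copies (up to complement) to the top row of its image. -/
def topBit : A16 → Bool
  | .C | .D | .G | .H | .K | .L | .O | .P => true
  | _ => false

/-- The bit of a letter that `mu` copies to the bottom row of its image. -/
def bottomBit : A16 → Bool
  | .B | .D | .F | .H | .J | .L | .N | .P => true
  | _ => false

theorem A16.ext_bits {x y : A16} (hl : leftBit x = leftBit y) (hr : rightBit x = rightBit y)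
    (ht : topBit x = topBit y) (hb : bottomBit x = bottomBit y) : x = y := by
  revert hl hr ht hb
  cases x <;> cases y <;> decide

theorem bits_mu (x : A16) (i j : Fin 2) :
    leftBit (mu x i j) = (if j.val = 0 then leftBit x else rightBit x) ∧
    rightBit (mu x i j) = decide ((i.val + j.val) % 2 = 1) ∧
    topBit (mu x i j) = decide (i.val = 1) ∧
    bottomBit (mu x i j) =
      (if i.val = 0 then xor (topBit x) (decide (j.val = 1)) else bottomBit x) := by
  revert i j
  cases x <;> decide

/-- The left bits of the quarter-plane fixed point. -/
def leftPlane (r c : ℕ) : Bool := leftBit (quarterPlane r c)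

/-- The bottom bits of the quarter-plane fixed point. -/
def bottomPlane (r c : ℕ) : Bool := bottomBit (quarterPlane r c)

theorem rightBit_quarterPlane (r c : ℕ) :
    rightBit (quarterPlane r c) = decide ((r + c) % 2 = 1) := by
  rw [quarterPlane_eq_muE, muE, (bits_mu _ _ _).2.1]
  simp

theorem topBit_quarterPlane (r c : ℕ) : topBit (quarterPlane r c) = decide (r % 2 = 1) := by
  rw [quarterPlane_eq_muE, muE, (bits_mu _ _ _).2.2.1]

theorem leftPlane_of_even (r : ℕ) {c : ℕ} (hc : c % 2 = 0) :
    leftPlane r c = leftPlane (r / 2) (c / 2) := by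
  rw [leftPlane, quarterPlane_eq_muE, muE, (bits_mu _ _ _).1, if_pos hc, leftPlane]

theorem leftPlane_of_odd (r : ℕ) {c : ℕ} (hc : c % 2 = 1) :
    leftPlane r c = decide ((r / 2 + c / 2) % 2 = 1) := by
  rw [leftPlane, quarterPlane_eq_muE, muE, (bits_mu _ _ _).1, if_neg (by simp [hc]),
    rightBit_quarterPlane]

theorem bottomPlane_of_even {r : ℕ} (c : ℕ) (hr : r % 2 = 0) :
    bottomPlane r c = xor (decide (r / 2 % 2 = 1)) (decide (c % 2 = 1)) := by
  rw [bottomPlane, quarterPlane_eq_muE, muE, (bits_mu _ _ _).2.2.2, if_pos hr,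
    topBit_quarterPlane]

theorem bottomPlane_of_odd {r : ℕ} (c : ℕ) (hr : r % 2 = 1) :
    bottomPlane r c = bottomPlane (r / 2) (c / 2) := by
  rw [bottomPlane, quarterPlane_eq_muE, muE, (bits_mu _ _ _).2.2.2, if_neg (by simp [hr]),
    bottomPlane]

theorem leftPlane_succ_succ (r c : ℕ) :
    leftPlane (r + 1) (c + 1) =
      !(xor (leftPlane r (c + 1)) (xor (bottomPlane r c) (bottomPlane r (c + 1)))) := by
  induction r using Nat.strong_induction_on generalizing c with
  | _ r ih =>
    rcases Nat.mod_two_eq_zero_or_one r with hr | hr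
    · have hrow : leftPlane (r + 1) (c + 1) = leftPlane r (c + 1) := by
        have h : (r + 1) / 2 = r / 2 := by omega
        rcases Nat.mod_two_eq_zero_or_one (c + 1) with hc | hc
        · rw [leftPlane_of_even _ hc, leftPlane_of_even _ hc, h]
        · rw [leftPlane_of_odd _ hc, leftPlane_of_odd _ hc, h]
      rw [hrow, bottomPlane_of_even _ hr, bottomPlane_of_even _ hr]
      rcases Nat.mod_two_eq_zero_or_one c with hc | hc
      · have hc' : (c + 1) % 2 = 1 := by omega
        simp [hc, hc']
      · have hc' : (c + 1) % 2 = 0 := by omega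
        simp [hc, hc']
    · have h : (r + 1) / 2 = r / 2 + 1 := by omega
      rw [bottomPlane_of_odd _ hr, bottomPlane_of_odd _ hr]
      rcases Nat.mod_two_eq_zero_or_one c with hc | hc
      · have hc' : (c + 1) % 2 = 1 := by omega
        have hd : (c + 1) / 2 = c / 2 := by omega
        rw [leftPlane_of_odd _ hc', leftPlane_of_odd _ hc', h, hd]
        rcases Nat.mod_two_eq_zero_or_one (r / 2 + c / 2) with hs | hs
        · have hs' : (r / 2 + 1 + c / 2) % 2 = 1 := by omega
          simp [hs, hs']
        · have hs' : (r / 2 + 1 + c / 2) % 2 = 0 := by omega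
          simp [hs, hs']
      · have hc' : (c + 1) % 2 = 0 := by omega
        have hd : (c + 1) / 2 = c / 2 + 1 := by omega
        rw [leftPlane_of_even _ hc', leftPlane_of_even _ hc', h, hd, ih (r / 2) (by omega)]

/-- The `m × n` window of the quarter plane with corner `p`: the parities of `p`, the left bits
outside the first `x` columns and the bottom bits outside the last `y` rows. -/
def obs (x y m n : ℕ) (p : ℕ × ℕ) :
    (Bool × Bool) × (Fin m → Fin n → Bool) × (Fin m → Fin n → Bool) :=
  ((decide (p.1 % 2 = 1), decide (p.2 % 2 = 1)),
    (fun a b => if x ≤ b then leftPlane (p.1 + a) (p.2 + b) else false),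
    (fun a b => if a + y < m then bottomPlane (p.1 + a) (p.2 + b) else false))

theorem obs_eq_iff {x y m n : ℕ} {p q : ℕ × ℕ} :
    obs x y m n p = obs x y m n q ↔
      (p.1 % 2 = q.1 % 2 ∧ p.2 % 2 = q.2 % 2) ∧
      (∀ a b, a < m → b < n → x ≤ b →
        leftPlane (p.1 + a) (p.2 + b) = leftPlane (q.1 + a) (q.2 + b)) ∧
      (∀ a b, a < m → b < n → a + y < m →
        bottomPlane (p.1 + a) (p.2 + b) = bottomPlane (q.1 + a) (q.2 + b)) := by
  have par : ∀ s t : ℕ, (decide (s % 2 = 1) = decide (t % 2 = 1)) ↔ s % 2 = t % 2 := by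
    intro s t
    rw [decide_eq_decide]
    omega
  simp only [obs, Prod.mk.injEq, par]
  refine and_congr Iff.rfl (and_congr ⟨fun h a b ha hb hx => ?_, fun h => ?_⟩
    ⟨fun h a b ha hb hy => ?_, fun h => ?_⟩)
  · simpa only [if_pos hx] using congrFun (congrFun h ⟨a, ha⟩) ⟨b, hb⟩
  · funext a b
    split_ifs with hx
    · exact h a b a.2 b.2 hx
    · rfl
  · simpa only [if_pos hy] using congrFun (congrFun h ⟨a, ha⟩) ⟨b, hb⟩
  · funext a b
    split_ifs with hy
    · exact h a b a.2 b.2 hy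
    · rfl

theorem ncard_range_congr {ι α β : Type*} {f : ι → α} {g : ι → β}
    (h : ∀ s t, f s = f t ↔ g s = g t) : (Set.range f).ncard = (Set.range g).ncard := by
  have e : Setoid.ker f = Setoid.ker g := Setoid.ext h
  rw [← Nat.card_coe_set_eq, ← Nat.card_coe_set_eq,
    ← Nat.card_congr (Setoid.quotientKerEquivRange f),
    ← Nat.card_congr (Setoid.quotientKerEquivRange g), e]

theorem ncard_range_eq_add {ι κ₁ κ₂ α : Type*} [Finite α] (f : ι → α) (e₁ : κ₁ → ι) (e₂ : κ₂ → ι)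
    (cover : ∀ s, s ∈ Set.range e₁ ∨ s ∈ Set.range e₂) (sep : ∀ s t, f (e₁ s) ≠ f (e₂ t)) :
    (Set.range f).ncard = (Set.range (f ∘ e₁)).ncard + (Set.range (f ∘ e₂)).ncard := by
  have hU : Set.range f = Set.range (f ∘ e₁) ∪ Set.range (f ∘ e₂) := by
    ext z
    constructor
    · rintro ⟨s, rfl⟩
      rcases cover s with ⟨t, rfl⟩ | ⟨t, rfl⟩
      · exact Or.inl ⟨t, rfl⟩
      · exact Or.inr ⟨t, rfl⟩
    · rintro (⟨t, rfl⟩ | ⟨t, rfl⟩)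
      · exact ⟨_, rfl⟩
      · exact ⟨_, rfl⟩
  rw [hU, Set.ncard_union_eq ?_ (Set.toFinite _) (Set.toFinite _)]
  rw [Set.disjoint_left]
  rintro _ ⟨s, rfl⟩ ⟨t, ht⟩
  exact sep s t ht.symm

/-- The number of `m × n` windows, up to the bits forgotten by `obs x y`. -/
noncomputable def windowCount (x y m n : ℕ) : ℕ := (Set.range (obs x y m n)).ncard

/-- The number of `m × n` windows with corner in the residue class of `(i, j)` modulo 2, up to
the bits forgotten by `obs x y`. -/
noncomputable def classCount (i j x y m n : ℕ) : ℕ :=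
  (Set.range fun p : ℕ × ℕ => obs x y m n (2 * p.1 + i, 2 * p.2 + j)).ncard

theorem card_Pij_eq_classCount {i j m n : ℕ} (hi : i < 2) (hj : j < 2) (hm : 1 ≤ m)
    (hn : 1 ≤ n) : Nat.card (Pij (i + 1) (j + 1) m n) = classCount i j 0 0 m n := by
  rw [Nat.card_coe_set_eq, Pij_eq_range hi hj hm hn, classCount]
  refine ncard_range_congr fun p q => ?_
  rw [obs_eq_iff]
  constructor
  · intro h
    refine ⟨⟨by simp only; omega, by simp only; omega⟩, fun a b ha hb _ => ?_,
      fun a b ha hb _ => ?_⟩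
    · exact congrArg leftBit (congrFun (congrFun h ⟨a, ha⟩) ⟨b, hb⟩)
    · exact congrArg bottomBit (congrFun (congrFun h ⟨a, ha⟩) ⟨b, hb⟩)
  · rintro ⟨-, hl, hb⟩
    funext a b
    refine A16.ext_bits (hl a b a.2 b.2 (by omega)) ?_ ?_ (hb a b a.2 b.2 (by omega))
    · rw [rightBit_quarterPlane, rightBit_quarterPlane, decide_eq_decide]
      omega
    · rw [topBit_quarterPlane, topBit_quarterPlane, decide_eq_decide]
      omega

theorem windowCount_eq_sum (x y m n : ℕ) :
    windowCount x y m n = classCount 0 0 x y m n + classCount 0 1 x y m n +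
      classCount 1 0 x y m n + classCount 1 1 x y m n := by
  have hrow : ∀ p q, obs x y m n p = obs x y m n q → p.1 % 2 = q.1 % 2 :=
    fun p q h => (obs_eq_iff.1 h).1.1
  have hcol : ∀ p q, obs x y m n p = obs x y m n q → p.2 % 2 = q.2 % 2 :=
    fun p q h => (obs_eq_iff.1 h).1.2
  have hsplit : ∀ i : ℕ,
      (Set.range fun p : ℕ × ℕ => obs x y m n (2 * p.1 + i, p.2)).ncard =
        classCount i 0 x y m n + classCount i 1 x y m n := by
    intro i
    refine ncard_range_eq_add _ (fun p : ℕ × ℕ => (p.1, 2 * p.2 + 0))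
      (fun p : ℕ × ℕ => (p.1, 2 * p.2 + 1)) (fun s => ?_) (fun s t h => ?_)
    · rcases Nat.mod_two_eq_zero_or_one s.2 with h | h
      · exact Or.inl ⟨(s.1, s.2 / 2), Prod.ext rfl (by simp only; omega)⟩
      · exact Or.inr ⟨(s.1, s.2 / 2), Prod.ext rfl (by simp only; omega)⟩
    · have := hcol _ _ h
      simp only at this
      omega
  rw [add_assoc _ (classCount 1 0 x y m n), ← hsplit, ← hsplit]
  refine ncard_range_eq_add _ (fun p : ℕ × ℕ => (2 * p.1 + 0, p.2))
    (fun p : ℕ × ℕ => (2 * p.1 + 1, p.2)) (fun s => ?_) (fun s t h => ?_)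
  · rcases Nat.mod_two_eq_zero_or_one s.1 with h | h
    · exact Or.inl ⟨(s.1 / 2, s.2), Prod.ext (by simp only; omega) rfl⟩
    · exact Or.inr ⟨(s.1 / 2, s.2), Prod.ext (by simp only; omega) rfl⟩
  · have := hrow _ _ h
    simp only at this
    omega

theorem obs_child_eq_iff {i j x y m n : ℕ} (hi : i < 2) (hj : j < 2) (hx : x < 2) (hy : y < 2)
    (hm : y + 2 ≤ m) (hn : x + 2 ≤ n) {r c r' c' : ℕ} :
    obs x y m n (2 * r + i, 2 * c + j) = obs x y m n (2 * r' + i, 2 * c' + j) ↔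
      obs (max x j) (max y ((m + i) % 2)) ((m + i + 1) / 2) ((n + j + 1) / 2) (r, c) =
        obs (max x j) (max y ((m + i) % 2)) ((m + i + 1) / 2) ((n + j + 1) / 2) (r', c') := by
  rw [obs_eq_iff, obs_eq_iff]
  simp only
  constructor
  · rintro ⟨-, hl, hb⟩
    have hr : r % 2 = r' % 2 := by
      have h := hb i 0 (by omega) (by omega) (by omega)
      rw [bottomPlane_of_even _ (by omega), bottomPlane_of_even _ (by omega),
        show (2 * c + j + 0) % 2 = (2 * c' + j + 0) % 2 by omega, Bool.xor_left_inj,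
        decide_eq_decide] at h
      omega
    have hc : c % 2 = c' % 2 := by
      obtain ⟨b, hb, hxb, hjb⟩ : ∃ b, b < n ∧ x ≤ b ∧ (j + b) % 2 = 1 := by
        rcases Nat.mod_two_eq_zero_or_one (j + x) with h | h
        · exact ⟨x + 1, by omega, by omega, by omega⟩
        · exact ⟨x, by omega, by omega, by omega⟩
      have h := hl 0 b (by omega) hb hxb
      rw [leftPlane_of_odd _ (by omega), leftPlane_of_odd _ (by omega),
        decide_eq_decide] at h
      omega
    refine ⟨⟨hr, hc⟩, fun a b ha hb' hab => ?_, fun a b ha hb' hab => ?_⟩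
    · have h := (leftPlane_of_even _ (by omega)).symm.trans
        ((hl (2 * a - i) (2 * b - j) (by omega) (by omega) (by omega)).trans
          (leftPlane_of_even _ (by omega)))
      convert h using 2 <;> omega
    · have h := (bottomPlane_of_odd _ (by omega)).symm.trans
        ((hb (2 * a + 1 - i) (2 * b - j) (by omega) (by omega) (by omega)).trans
          (bottomPlane_of_odd _ (by omega)))
      convert h using 2 <;> omega
  · rintro ⟨⟨hr, hc⟩, hl, hb⟩
    have half : ∀ R s t : ℕ, (2 * R + s + t) / 2 = R + (s + t) / 2 := by omega
    refine ⟨⟨by omega, by omega⟩, fun a b ha hb' hab => ?_, fun a b ha hb' hab => ?_⟩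
    · rcases Nat.mod_two_eq_zero_or_one (j + b) with h | h
      · refine (leftPlane_of_even _ (by omega)).trans
          (Eq.trans ?_ (leftPlane_of_even _ (by omega)).symm)
        rw [half, half, half, half]
        exact hl _ _ (by omega) (by omega) (by omega)
      · rw [leftPlane_of_odd _ (by omega), leftPlane_of_odd _ (by omega), decide_eq_decide]
        omega
    · rcases Nat.mod_two_eq_zero_or_one (i + a) with h | h
      · rw [bottomPlane_of_even _ (by omega), bottomPlane_of_even _ (by omega)]
        congr 1 <;> rw [decide_eq_decide] <;> omega
      · refine (bottomPlane_of_odd _ (by omega)).trans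
          (Eq.trans ?_ (bottomPlane_of_odd _ (by omega)).symm)
        rw [half, half, half, half]
        exact hb _ _ (by omega) (by omega) (by omega)

theorem classCount_eq_windowCount {i j x y m n : ℕ} (hi : i < 2) (hj : j < 2) (hx : x < 2)
    (hy : y < 2) (hm : y + 2 ≤ m) (hn : x + 2 ≤ n) :
    classCount i j x y m n =
      windowCount (max x j) (max y ((m + i) % 2)) ((m + i + 1) / 2) ((n + j + 1) / 2) :=
  ncard_range_congr fun _ _ => obs_child_eq_iff hi hj hx hy hm hn

theorem windowCount_one_one_succ {m : ℕ} (hm : 1 ≤ m) (n : ℕ) :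
    windowCount 1 1 (m + 1) n = windowCount 1 0 m n := by
  refine ncard_range_congr fun p q => ?_
  rw [obs_eq_iff, obs_eq_iff]
  constructor
  · rintro ⟨hpar, hl, hb⟩
    exact ⟨hpar, fun a b ha => hl a b (by omega), fun a b ha hb' _ =>
      hb a b (by omega) hb' (by omega)⟩
  · rintro ⟨hpar, hl, hb⟩
    refine ⟨hpar, fun a b ha hb' hab => ?_, fun a b ha hb' hab =>
      hb a b (by omega) hb' (by omega)⟩
    rcases Nat.lt_succ_iff_lt_or_eq.1 ha with h | rfl
    · exact hl a b h hb' hab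
    · obtain ⟨a, rfl⟩ : ∃ a', a = a' + 1 := ⟨a - 1, by omega⟩
      obtain ⟨b, rfl⟩ : ∃ b', b = b' + 1 := ⟨b - 1, by omega⟩
      simp only [← add_assoc]
      rw [leftPlane_succ_succ, leftPlane_succ_succ]
      simp only [add_assoc]
      rw [hl a (b + 1) (by omega) hb' hab, hb a b (by omega) (by omega) (by omega),
        hb a (b + 1) (by omega) hb' (by omega)]

theorem card_Pij_eq_windowCount {i j m n : ℕ} (hi : i < 2) (hj : j < 2) (hm : 2 ≤ m)
    (hn : 2 ≤ n) :
    Nat.card (Pij (i + 1) (j + 1) m n) =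
      windowCount j ((m + i) % 2) ((m + i + 1) / 2) ((n + j + 1) / 2) := by
  rw [card_Pij_eq_classCount hi hj (by omega) (by omega),
    classCount_eq_windowCount hi hj (by omega) (by omega) (by omega) (by omega),
    Nat.zero_max, Nat.zero_max]

theorem windowCount_even_odd {x y k l : ℕ} (hx : x < 2) (hy : y < 2)
    (hm : y + 2 ≤ 2 * k) (hn : x + 2 ≤ 2 * l + 1) :
    windowCount x y (2 * k) (2 * l + 1) =
      windowCount x y k (l + 1) + windowCount 1 y k (l + 1) +
        windowCount x 1 (k + 1) (l + 1) + windowCount 1 1 (k + 1) (l + 1) := by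
  rw [windowCount_eq_sum]
  simp only [classCount_eq_windowCount, hx, hy, hm, hn, Nat.zero_lt_two, Nat.one_lt_two]
  refine congrArg₂ _ (congrArg₂ _ (congrArg₂ _ ?_ ?_) ?_) ?_ <;> congr 1 <;> omega

theorem windowCount_odd_even {x y k l : ℕ} (hx : x < 2) (hy : y < 2)
    (hm : y + 2 ≤ 2 * k + 1) (hn : x + 2 ≤ 2 * l) :
    windowCount x y (2 * k + 1) (2 * l) =
      windowCount x 1 (k + 1) l + windowCount 1 1 (k + 1) (l + 1) +
        windowCount x y (k + 1) l + windowCount 1 y (k + 1) (l + 1) := by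
  rw [windowCount_eq_sum]
  simp only [classCount_eq_windowCount, hx, hy, hm, hn, Nat.zero_lt_two, Nat.one_lt_two]
  refine congrArg₂ _ (congrArg₂ _ (congrArg₂ _ ?_ ?_) ?_) ?_ <;> congr 1 <;> omega

theorem aT_even {k : ℕ} (hk : 1 ≤ k) :
    aT 1 1 (2 * k) = windowCount 0 0 k k ∧
    aT 1 2 (2 * k) = windowCount 1 0 k (k + 1) ∧
    aT 2 1 (2 * k) = windowCount 0 1 (k + 1) k ∧
    aT 2 2 (2 * k) = windowCount 1 1 (k + 1) (k + 1) := by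
  refine ⟨?_, ?_, ?_, ?_⟩
  · exact (card_Pij_eq_windowCount (i := 0) (j := 0) (by omega) (by omega) (by omega)
      (by omega)).trans (by congr 1 <;> omega)
  · exact (card_Pij_eq_windowCount (i := 0) (j := 1) (by omega) (by omega) (by omega)
      (by omega)).trans (by congr 1 <;> omega)
  · exact (card_Pij_eq_windowCount (i := 1) (j := 0) (by omega) (by omega) (by omega)
      (by omega)).trans (by congr 1 <;> omega)
  · exact (card_Pij_eq_windowCount (i := 1) (j := 1) (by omega) (by omega) (by omega)
      (by omega)).trans (by congr 1 <;> omega)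

theorem aT_odd {k : ℕ} (hk : 1 ≤ k) :
    aT 1 1 (2 * k + 1) = windowCount 0 1 (k + 1) (k + 1) ∧
    aT 1 2 (2 * k + 1) = windowCount 1 1 (k + 1) (k + 1) ∧
    aT 2 1 (2 * k + 1) = windowCount 0 0 (k + 1) (k + 1) ∧
    aT 2 2 (2 * k + 1) = windowCount 1 0 (k + 1) (k + 1) := by
  refine ⟨?_, ?_, ?_, ?_⟩
  · exact (card_Pij_eq_windowCount (i := 0) (j := 0) (by omega) (by omega) (by omega)
      (by omega)).trans (by congr 1 <;> omega)
  · exact (card_Pij_eq_windowCount (i := 0) (j := 1) (by omega) (by omega) (by omega)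
      (by omega)).trans (by congr 1 <;> omega)
  · exact (card_Pij_eq_windowCount (i := 1) (j := 0) (by omega) (by omega) (by omega)
      (by omega)).trans (by congr 1 <;> omega)
  · exact (card_Pij_eq_windowCount (i := 1) (j := 1) (by omega) (by omega) (by omega)
      (by omega)).trans (by congr 1 <;> omega)

theorem bT_even {k : ℕ} (hk : 1 ≤ k) :
    bT 1 1 (2 * k) = windowCount 0 0 k (k + 1) ∧
    bT 1 2 (2 * k) = windowCount 1 0 k (k + 1) ∧
    bT 2 1 (2 * k) = windowCount 0 1 (k + 1) (k + 1) ∧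
    bT 2 2 (2 * k) = windowCount 1 1 (k + 1) (k + 1) := by
  refine ⟨?_, ?_, ?_, ?_⟩
  · exact (card_Pij_eq_windowCount (i := 0) (j := 0) (by omega) (by omega) (by omega)
      (by omega)).trans (by congr 1 <;> omega)
  · exact (card_Pij_eq_windowCount (i := 0) (j := 1) (by omega) (by omega) (by omega)
      (by omega)).trans (by congr 1 <;> omega)
  · exact (card_Pij_eq_windowCount (i := 1) (j := 0) (by omega) (by omega) (by omega)
      (by omega)).trans (by congr 1 <;> omega)
  · exact (card_Pij_eq_windowCount (i := 1) (j := 1) (by omega) (by omega) (by omega)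
      (by omega)).trans (by congr 1 <;> omega)

theorem bT_odd {k : ℕ} (hk : 1 ≤ k) :
    bT 1 1 (2 * k + 1) = windowCount 0 1 (k + 1) (k + 1) ∧
    bT 1 2 (2 * k + 1) = windowCount 1 1 (k + 1) (k + 2) ∧
    bT 2 1 (2 * k + 1) = windowCount 0 0 (k + 1) (k + 1) ∧
    bT 2 2 (2 * k + 1) = windowCount 1 0 (k + 1) (k + 2) := by
  refine ⟨?_, ?_, ?_, ?_⟩
  · exact (card_Pij_eq_windowCount (i := 0) (j := 0) (by omega) (by omega) (by omega)
      (by omega)).trans (by congr 1 <;> omega)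
  · exact (card_Pij_eq_windowCount (i := 0) (j := 1) (by omega) (by omega) (by omega)
      (by omega)).trans (by congr 1 <;> omega)
  · exact (card_Pij_eq_windowCount (i := 1) (j := 0) (by omega) (by omega) (by omega)
      (by omega)).trans (by congr 1 <;> omega)
  · exact (card_Pij_eq_windowCount (i := 1) (j := 1) (by omega) (by omega) (by omega)
      (by omega)).trans (by congr 1 <;> omega)

/-- The system of recursions for the quantities b_{i,j}. -/
theorem recursion_system_b (n : ℕ) (hn : 1 ≤ n) :
    (bT 1 1 (4 * n) =
        bT 1 1 (2 * n) + 2 * aT 1 2 (2 * n) + aT 1 1 (2 * n + 1)) ∧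
    (bT 1 2 (4 * n) = aT 1 2 (4 * n)) ∧
    (bT 2 1 (4 * n) = aT 1 1 (4 * n + 1)) ∧
    (bT 2 2 (4 * n) = aT 2 2 (4 * n)) ∧
    (bT 1 1 (4 * n + 1) = aT 1 1 (4 * n + 1)) ∧
    (bT 1 2 (4 * n + 1) = 2 * aT 1 2 (2 * n) + 2 * bT 1 2 (2 * n + 1)) ∧
    (bT 2 1 (4 * n + 1) = aT 2 1 (4 * n + 1)) ∧
    (bT 2 2 (4 * n + 1) = aT 1 2 (4 * n + 2)) ∧
    (bT 1 1 (4 * n + 2) =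
        aT 1 1 (2 * n + 1) + bT 1 2 (2 * n + 1) + aT 1 1 (2 * n + 2) +
          aT 1 2 (2 * n + 2)) ∧
    (bT 1 2 (4 * n + 2) = aT 1 2 (4 * n + 2)) ∧
    (bT 2 1 (4 * n + 2) = aT 1 1 (4 * n + 3)) ∧
    (bT 2 2 (4 * n + 2) = aT 2 2 (4 * n + 2)) ∧
    (bT 1 1 (4 * n + 3) = aT 1 1 (4 * n + 3)) ∧
    (bT 1 2 (4 * n + 3) = 2 * bT 1 2 (2 * n + 1) + 2 * aT 1 2 (2 * n + 2)) ∧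
    (bT 2 1 (4 * n + 3) = aT 2 1 (4 * n + 3)) ∧
    (bT 2 2 (4 * n + 3) = 4 * aT 1 2 (2 * n + 2)) := by
  have hsum00 := windowCount_even_odd (x := 0) (y := 0) (k := n) (l := n)
    (by omega) (by omega) (by omega) (by omega)
  have hsum11 := windowCount_odd_even (x := 1) (y := 1) (k := n) (l := n + 1)
    (by omega) (by omega) (by omega) (by omega)
  have hsum00_odd := windowCount_odd_even (x := 0) (y := 0) (k := n) (l := n + 1)
    (by omega) (by omega) (by omega) (by omega)
  have hsum11_succ := windowCount_even_odd (x := 1) (y := 1) (k := n + 1) (l := n + 1)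
    (by omega) (by omega) (by omega) (by omega)
  have hsum10_succ := windowCount_even_odd (x := 1) (y := 0) (k := n + 1) (l := n + 1)
    (by omega) (by omega) (by omega) (by omega)
  have hforget : windowCount 1 1 (n + 1) (n + 1) = windowCount 1 0 n (n + 1) :=
    windowCount_one_one_succ hn _
  have hforget' : windowCount 1 1 (n + 2) (n + 2) = windowCount 1 0 (n + 1) (n + 2) :=
    windowCount_one_one_succ (by omega) _
  have h4 : 4 * n = 2 * (2 * n) := by omega
  have h2 : ∀ k, 2 * k + 2 = 2 * (k + 1) := fun k => rfl
  have h3 : ∀ k, 2 * k + 3 = 2 * (k + 1) + 1 := fun k => rfl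
  have hn2 : 1 ≤ 2 * n := by omega
  simp only [h4, h2, h3, aT_even, aT_odd, bT_even, bT_odd, hn, hn2, Nat.le_add_left]
  simp only [mul_add, mul_one, add_assoc, Nat.reduceAdd, true_and]
    at hsum00 hsum11 hsum00_odd hsum11_succ hsum10_succ ⊢
  refine ⟨?_, ?_, ?_, ?_, ?_⟩ <;> omega
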